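/- arXiv:1611.02878 — 2 statements merged into one kernel-verified Lean document; each statement's English description precedes it below -/
import Mathlib

section
/- Suppose ν(2) = 1, and let f = 2³·x_3² + (x_1 − x_2)·x_3 + (x_1² − 2x_2) ∈ K[x_1,x_2,x_3]. Then for all z_1, z_2 ∈ K with ν(z_1) = 2 and ν(z_2) = 1, there exists z_3 ∈ K with ν(z_3) = 1 and f(z_1, z_2, z_3) = 0. In particular, if 2 and 1 lie in ν(Kˣ), then (2, 1, 1) ∈ Trop(f) = closure{(ν(z_1),ν(z_2),ν(z_3)) : z ∈ (Kˣ)³, f(z) = 0}. -/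
open scoped Pointwise

/-- A quadratic `a z² + b z + c` over an algebraically closed field whose Newton polygon has a vertex
at the linear term has a root of valuation `v c - v b`. -/
theorem exists_quadratic_root_of_newton_vertex {K : Type*} [Field K] [IsAlgClosed K]
    (v : AddValuation K (WithTop ℝ)) {a b c : K} {α β γ : ℝ}
    (ha : v a = (α : WithTop ℝ)) (hb : v b = (β : WithTop ℝ)) (hc : v c = (γ : WithTop ℝ))
    (hlt : 2 * β < α + γ) :
    ∃ z : K, v z = ((γ - β : ℝ) : WithTop ℝ) ∧ a * z ^ 2 + b * z + c = 0 := by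
  have ne_zero {x : K} {ξ : ℝ} (hx : v x = (ξ : WithTop ℝ)) : x ≠ 0 := by
    rintro rfl
    simp at hx
  have ha0 := ne_zero ha
  have hc0 := ne_zero hc
  obtain ⟨r, hr⟩ : ∃ r : K, a * r ^ 2 + b * r + c = 0 := by
    obtain ⟨r, hr⟩ := IsAlgClosed.exists_root
      (Polynomial.C a * Polynomial.X ^ 2 + Polynomial.C b * Polynomial.X + Polynomial.C c)
      (by rw [Polynomial.degree_quadratic ha0]; decide)
    exact ⟨r, by simpa using hr⟩
  obtain ⟨s, hs⟩ : ∃ s : K, a * (r + s) = -b := ⟨-b / a - r, by field_simp; ring⟩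
  have hprod : a * (r * s) = c := by linear_combination r * hs - hr
  have hsroot : a * s ^ 2 + b * s + c = 0 := by linear_combination s * hs - hprod
  have hr0 : r ≠ 0 := by rintro rfl; simp at hprod; exact hc0 hprod.symm
  have hs0 : s ≠ 0 := by rintro rfl; simp at hprod; exact hc0 hprod.symm
  obtain ⟨x, hx⟩ := WithTop.ne_top_iff_exists.1 ((v.ne_top_iff).2 hr0)
  obtain ⟨y, hy⟩ := WithTop.ne_top_iff_exists.1 ((v.ne_top_iff).2 hs0)
  have hxy : α + (x + y) = γ := by
    have := congrArg v hprod
    rw [v.map_mul, v.map_mul, ha, hc, ← hx, ← hy] at this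
    exact_mod_cast this
  have hsum : (α : WithTop ℝ) + v (r + s) = β := by
    have := congrArg v hs
    rwa [v.map_mul, v.map_neg, ha, hb] at this
  rcases lt_trichotomy x y with h | h | h
  · rw [v.map_add_eq_of_lt_left (by rw [← hx, ← hy]; exact_mod_cast h), ← hx] at hsum
    have hx' : α + x = β := by exact_mod_cast hsum
    refine ⟨s, ?_, hsroot⟩
    rw [← hy, show y = γ - β by linarith]
  · obtain ⟨w, hw⟩ : ∃ w : ℝ, (w : WithTop ℝ) = v (r + s) := by
      refine WithTop.ne_top_iff_exists.1 fun htop => ?_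
      simp [htop] at hsum
    have hmin := v.map_add r s
    rw [← hw] at hsum hmin
    rw [← hx, ← hy, h, min_self] at hmin
    have hw' : α + w = β := by exact_mod_cast hsum
    have hyw : y ≤ w := by exact_mod_cast hmin
    linarith
  · rw [v.map_add_eq_of_lt_right (by rw [← hx, ← hy]; exact_mod_cast h), ← hy] at hsum
    have hy' : α + y = β := by exact_mod_cast hsum
    refine ⟨r, ?_, hr⟩
    rw [← hx, show x = γ - β by linarith]

theorem stmt10 {K : Type*} [Field K] [IsAlgClosed K] (ν : K → WithTop ℝ)
    (hν0 : ∀ a : K, ν a = ⊤ ↔ a = 0)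
    (hνM : ∀ a b : K, ν (a * b) = ν a + ν b)
    (hνA : ∀ a b : K, min (ν a) (ν b) ≤ ν (a + b))
    (h2 : ν (2 : K) = ((1 : ℝ) : WithTop ℝ)) :
    (∀ z1 z2 : K, ν z1 = ((2 : ℝ) : WithTop ℝ) → ν z2 = ((1 : ℝ) : WithTop ℝ) →
      ∃ z3 : K, ν z3 = ((1 : ℝ) : WithTop ℝ) ∧
        2 ^ 3 * z3 ^ 2 + (z1 - z2) * z3 + (z1 ^ 2 - 2 * z2) = 0) ∧
    (![2, 1, 1] : Fin 3 → ℝ) ∈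
      closure {v : Fin 3 → ℝ | ∃ z : Fin 3 → K, (∀ j, z j ≠ 0) ∧
        2 ^ 3 * z 2 ^ 2 + (z 0 - z 1) * z 2 + (z 0 ^ 2 - 2 * z 1) = 0 ∧
        ∀ j, ν (z j) = (v j : WithTop ℝ)} := by
  have hν1 : ν 1 = 0 := by
    obtain ⟨e, he⟩ := WithTop.ne_top_iff_exists.1 (mt (hν0 1).1 one_ne_zero)
    have h := hνM 1 1
    rw [mul_one, ← he] at h
    have h' : e = e + e := by exact_mod_cast h
    rw [← he, show e = 0 by linarith, WithTop.coe_zero]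
  let v : AddValuation K (WithTop ℝ) := AddValuation.of ν ((hν0 0).2 rfl) hν1 hνA hνM
  have hv2 : v 2 = ((1 : ℝ) : WithTop ℝ) := h2
  have hroot : ∀ z1 z2 : K, ν z1 = ((2 : ℝ) : WithTop ℝ) → ν z2 = ((1 : ℝ) : WithTop ℝ) →
      ∃ z3 : K, ν z3 = ((1 : ℝ) : WithTop ℝ) ∧
        2 ^ 3 * z3 ^ 2 + (z1 - z2) * z3 + (z1 ^ 2 - 2 * z2) = 0 := by
    intro z1 z2 h1 hz2
    replace h1 : v z1 = ((2 : ℝ) : WithTop ℝ) := h1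
    replace hz2 : v z2 = ((1 : ℝ) : WithTop ℝ) := hz2
    have hsq : v (z1 ^ 2) = ((4 : ℝ) : WithTop ℝ) := by
      rw [pow_two, v.map_mul, h1, ← WithTop.coe_add]
      norm_num
    have hmul : v (2 * z2) = ((2 : ℝ) : WithTop ℝ) := by
      rw [v.map_mul, hv2, hz2, ← WithTop.coe_add]
      norm_num
    have ha : v (2 ^ 3) = ((3 : ℝ) : WithTop ℝ) := by
      rw [pow_succ, pow_two, v.map_mul, v.map_mul, hv2, ← WithTop.coe_add, ← WithTop.coe_add]
      norm_num
    have hb : v (z1 - z2) = ((1 : ℝ) : WithTop ℝ) := by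
      rw [sub_eq_add_neg, v.map_add_eq_of_lt_right, v.map_neg, hz2]
      rw [v.map_neg, h1, hz2, WithTop.coe_lt_coe]
      norm_num
    have hc : v (z1 ^ 2 - 2 * z2) = ((2 : ℝ) : WithTop ℝ) := by
      rw [sub_eq_add_neg, v.map_add_eq_of_lt_right, v.map_neg, hmul]
      rw [v.map_neg, hsq, hmul, WithTop.coe_lt_coe]
      norm_num
    obtain ⟨z3, hz3, h⟩ := exists_quadratic_root_of_newton_vertex v ha hb hc (by norm_num)
    exact ⟨z3, hz3.trans (by norm_num), h⟩
  refine ⟨hroot, subset_closure ?_⟩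
  have h4 : ν (2 * 2) = ((2 : ℝ) : WithTop ℝ) := by
    rw [hνM, h2, ← WithTop.coe_add]
    norm_num
  obtain ⟨z3, hz3, h⟩ := hroot (2 * 2) 2 h4 h2
  have hval : ∀ j, ν (![2 * 2, 2, z3] j) = ((![2, 1, 1] : Fin 3 → ℝ) j : WithTop ℝ) := by
    intro j
    fin_cases j
    exacts [h4, h2, hz3]
  refine ⟨![2 * 2, 2, z3], fun j hj => ?_, h, hval⟩
  exact WithTop.coe_ne_top ((hval j).symm.trans ((hν0 _).2 hj))
end

section
/- Suppose there exists t ∈ Kˣ with ν(t) = 1. Let I ⊴ K[x_0,…,x_9] be the Plücker ideal of the Grassmannian Gr(2,5), generated by x_2x_9 − x_4x_8 + x_5x_7, x_1x_9 − x_3x_8 + x_5x_6, x_0x_9 − x_3x_7 + x_4x_6, x_0x_8 − x_1x_7 + x_2x_6, and x_0x_5 − x_1x_4 + x_2x_3. Then there exists z ∈ (Kˣ)^{10} with f(z) = 0 for all five generators f, such that (ν(z_0),…,ν(z_9)) = (0, −6, −2, 1, 5, 3, 7, 8, 2, 9); in particular (0, −6, −2, 1, 5, 3, 7, 8, 2,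 9) ∈ Trop(I). (Explicitly, one may take z_3,…,z_9 = t, t^5, t^3, t^7, t^8, t^2, t^9 and z_0 = 1 − t³, z_1 = (1 − t^7)/t^6, z_2 = (1 − t^4)/t².) -/
open scoped Pointwise

/-- A function satisfying the three valuation axioms takes the value `0` at `1`. -/
theorem map_one_of_valuation_axioms {K : Type*} [Field K] {ν : K → WithTop ℝ}
    (hν0 : ∀ a : K, ν a = ⊤ ↔ a = 0) (hνM : ∀ a b : K, ν (a * b) = ν a + ν b) : ν 1 = 0 := by
  have h := hνM 1 1
  rw [mul_one] at h
  lift ν 1 to ℝ using fun h1 => one_ne_zero ((hν0 1).1 h1) with r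
  norm_cast at h ⊢
  linarith

/-- If `a` has positive valuation, then `1 - a` has valuation `0`. -/
theorem AddValuation.map_one_sub_of_pos {K Γ : Type*} [Ring K]
    [LinearOrderedAddCommMonoidWithTop Γ] (v : AddValuation K Γ) {a : K} (ha : 0 < v a) :
    v (1 - a) = 0 := by
  rw [← v.map_one] at ha ⊢
  exact v.map_sub_eq_of_lt_left ha

theorem stmt11 {K : Type*} [Field K] [IsAlgClosed K] (ν : K → WithTop ℝ)
    (hν0 : ∀ a : K, ν a = ⊤ ↔ a = 0)
    (hνM : ∀ a b : K, ν (a * b) = ν a + ν b)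
    (hνA : ∀ a b : K, min (ν a) (ν b) ≤ ν (a + b))
    (t : K) (ht : ν t = ((1 : ℝ) : WithTop ℝ)) :
    (∃ z : Fin 10 → K, (∀ i, z i ≠ 0) ∧
      z 2 * z 9 - z 4 * z 8 + z 5 * z 7 = 0 ∧
      z 1 * z 9 - z 3 * z 8 + z 5 * z 6 = 0 ∧
      z 0 * z 9 - z 3 * z 7 + z 4 * z 6 = 0 ∧
      z 0 * z 8 - z 1 * z 7 + z 2 * z 6 = 0 ∧
      z 0 * z 5 - z 1 * z 4 + z 2 * z 3 = 0 ∧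
      ∀ i, ν (z i) = ((![0, -6, -2, 1, 5, 3, 7, 8, 2, 9] : Fin 10 → ℝ) i : WithTop ℝ)) ∧
    (![0, -6, -2, 1, 5, 3, 7, 8, 2, 9] : Fin 10 → ℝ) ∈
      closure {v : Fin 10 → ℝ | ∃ z : Fin 10 → K, (∀ i, z i ≠ 0) ∧
        z 2 * z 9 - z 4 * z 8 + z 5 * z 7 = 0 ∧
        z 1 * z 9 - z 3 * z 8 + z 5 * z 6 = 0 ∧
        z 0 * z 9 - z 3 * z 7 + z 4 * z 6 = 0 ∧
        z 0 * z 8 - z 1 * z 7 + z 2 * z 6 = 0 ∧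
        z 0 * z 5 - z 1 * z 4 + z 2 * z 3 = 0 ∧
        ∀ i, ν (z i) = (v i : WithTop ℝ)} := by
  have hν1 : ν 1 = 0 := map_one_of_valuation_axioms hν0 hνM
  let v : AddValuation K (WithTop ℝ) := AddValuation.of ν ((hν0 0).2 rfl) hν1 hνA hνM
  have hv : ∀ a, v a = ν a := fun _ => rfl
  have ht0 : t ≠ 0 := fun h => WithTop.coe_ne_top (ht.symm.trans ((hν0 t).2 h))
  have hpow : ∀ n : ℕ, ν (t ^ n) = ((n : ℝ) : WithTop ℝ) := fun n => by
    rw [← hv, v.map_pow, hv, ht, ← WithTop.coe_nsmul, nsmul_one]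
  have hone_sub : ∀ n : ℕ, 0 < n → ν (1 - t ^ n) = 0 := fun n hn =>
    v.map_one_sub_of_pos (by rw [hv, hpow]; exact_mod_cast hn)
  have hdiv : ∀ m n : ℕ, 0 < n → ν ((1 - t ^ n) / t ^ m) = ((-(m : ℝ) : ℝ) : WithTop ℝ) := by
    intro m n hn
    have h := hνM ((1 - t ^ n) / t ^ m) (t ^ m)
    rw [div_mul_cancel₀ _ (pow_ne_zero m ht0), hone_sub n hn, hpow] at h
    have hne : ν ((1 - t ^ n) / t ^ m) ≠ ⊤ := fun htop => by simp [htop] at h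
    lift ν ((1 - t ^ n) / t ^ m) to ℝ using hne with r
    norm_cast at h ⊢
    push_cast at h ⊢
    linarith
  suffices h : _ from ⟨h, subset_closure h⟩
  let z : Fin 10 → K := ![1 - t ^ 3, (1 - t ^ 7) / t ^ 6, (1 - t ^ 4) / t ^ 2,
    t, t ^ 5, t ^ 3, t ^ 7, t ^ 8, t ^ 2, t ^ 9]
  have hval : ∀ i, ν (z i) =
      ((![0, -6, -2, 1, 5, 3, 7, 8, 2, 9] : Fin 10 → ℝ) i : WithTop ℝ) := by
    intro i
    fin_cases i
    · exact hone_sub 3 (by norm_num)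
    · exact hdiv 6 7 (by norm_num)
    · exact hdiv 2 4 (by norm_num)
    · exact ht
    · exact hpow 5
    · exact hpow 3
    · exact hpow 7
    · exact hpow 8
    · exact hpow 2
    · exact hpow 9
  refine ⟨z, fun i hi => WithTop.coe_ne_top ((hval i).symm.trans ((hν0 _).2 hi)),
    ?_, ?_, ?_, ?_, ?_, hval⟩ <;>
  · simp only [z, Fin.isValue, Matrix.cons_val]
    field_simp
    ring
end
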